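/- arXiv:math/0409233 — 2 statements merged into one kernel-verified Lean document; each statement's English description precedes it below -/
import Mathlib

section
/- Let ξ be an extremal real number with an associated Fibonacci sequence (W_k)_{k≥1} in 𝒫, let N ∈ 𝒫 witness its admissibility (with N_i = ᵗN for odd i, N_i = N for even i, and y_i = W_i N_i symmetric for each i), let L = max{1,|ξ|}^{−1}·(1, ξ) be a row vector, and let θ = L N^{−1} ᵗL ∈ ℝ. Then θ ≠ 0, and there exist an index ℓ ≥ 1 and a constant c ≥ 1 such that for every finite sequence of integers (i₁, …, i_s) with all entries ≥ ℓ and with no value occurring more than twice, one has 1/c ≤ ‖W_{i₁} W_{i₂} ⋯ W_{i_s}‖ / (|θ|^s · ‖y_{i₁}‖ ‖y_{i₂}‖ ⋯ ‖y_{i_s}‖) ≤ c, the products of the W's being ordinary matrix products. -/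
open Matrix

/-- 2×2 integer matrices. -/
abbrev M2 : Type := Matrix (Fin 2) (Fin 2) ℤ

/-- The content of an integer matrix: the gcd of its coefficients. -/
def content (A : M2) : ℕ :=
  Nat.gcd (Nat.gcd (A 0 0).natAbs (A 0 1).natAbs) (Nat.gcd (A 1 0).natAbs (A 1 1).natAbs)

/-- A matrix is primitive if its content is 1. -/
def Primitive (A : M2) : Prop := content A = 1

/-- Membership in 𝒫: primitive with nonzero determinant. -/
def MemP (A : M2) : Prop := Primitive A ∧ A.det ≠ 0

/-- `A^red`: the primitive matrix such that `A = content A • A^red`. -/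
def red (A : M2) : M2 := Matrix.of fun i j => A i j / (content A : ℤ)

/-- The group operation of 𝒫: `A * B = (AB)^red`. -/
def pmul (A B : M2) : M2 := red (A * B)

/-- A Fibonacci sequence in 𝒫 (indices from 1). -/
def IsFibP (W : ℕ → M2) : Prop :=
  (∀ i, 1 ≤ i → MemP (W i)) ∧ ∀ i, 1 ≤ i → W (i + 2) = pmul (W (i + 1)) (W i)

/-- Admissibility of a Fibonacci sequence in 𝒫: there is a non-symmetric,
non-skew-symmetric N ∈ 𝒫 such that W_i N_i is symmetric for all i ≥ 1,
where N_i = ᵗN for odd i and N_i = N for even i. -/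
def AdmissibleFib (W : ℕ → M2) : Prop :=
  ∃ N : M2, MemP N ∧ N ≠ Nᵀ ∧ N ≠ -Nᵀ ∧
    ∀ i, 1 ≤ i → (W i * (if i % 2 = 1 then Nᵀ else N)).IsSymm

/-- The norm of an integer 2×2 matrix: max absolute value of coefficients, as a real. -/
noncomputable def mnorm (A : M2) : ℝ :=
  max (max |(A 0 0 : ℝ)| |(A 0 1 : ℝ)|) (max |(A 1 0 : ℝ)| |(A 1 1 : ℝ)|)

/-- The sequence is unbounded in norm. -/
def UnboundedSeq (W : ℕ → M2) : Prop := ∀ C : ℝ, ∃ i, 1 ≤ i ∧ C < mnorm (W i)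

/-- The golden ratio γ = (1+√5)/2. -/
noncomputable def gam : ℝ := (1 + Real.sqrt 5) / 2

/-- Norm of the row vector (ξ, -1)·A. -/
noncomputable def xiNorm (ξ : ℝ) (A : M2) : ℝ :=
  max |ξ * (A 0 0 : ℝ) - (A 1 0 : ℝ)| |ξ * (A 0 1 : ℝ) - (A 1 1 : ℝ)|

/-- ξ is extremal: neither rational nor quadratic over ℚ, and for each X ≥ 1 the system
|x₀| ≤ X, |x₀ξ - x₁| ≤ c X^(-1/γ), |x₀ξ² - x₂| ≤ c X^(-1/γ) has a nonzero integer solution. -/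
def IsExtremal (ξ : ℝ) : Prop :=
  (∀ a b c : ℚ, ¬(a = 0 ∧ b = 0 ∧ c = 0) → (a : ℝ) * ξ ^ 2 + (b : ℝ) * ξ + (c : ℝ) ≠ 0) ∧
  ∃ c : ℝ, 0 < c ∧ ∀ X : ℝ, 1 ≤ X → ∃ x₀ x₁ x₂ : ℤ,
    ¬(x₀ = 0 ∧ x₁ = 0 ∧ x₂ = 0) ∧ |(x₀ : ℝ)| ≤ X ∧
    |(x₀ : ℝ) * ξ - (x₁ : ℝ)| ≤ c * X ^ (-1 / gam) ∧
    |(x₀ : ℝ) * ξ ^ 2 - (x₂ : ℝ)| ≤ c * X ^ (-1 / gam)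

/-- The Fibonacci sequence `W` in 𝒫 is associated to the extremal real number ξ:
it is an unbounded admissible Fibonacci sequence in 𝒫 with
‖W_{i+1}‖ ≍ ‖W_i‖^γ, ‖(ξ,-1)W_i‖ ≍ ‖W_i‖⁻¹ and |det W_i| ≍ 1. -/
def IsAssociated (ξ : ℝ) (W : ℕ → M2) : Prop :=
  IsFibP W ∧ UnboundedSeq W ∧ AdmissibleFib W ∧
  ∃ c₁ c₂ c₃ c₄ c₅ c₆ : ℝ, 0 < c₁ ∧ 0 < c₂ ∧ 0 < c₃ ∧ 0 < c₄ ∧ 0 < c₅ ∧ 0 < c₆ ∧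
    ∀ i, 1 ≤ i →
      c₁ * mnorm (W i) ^ gam ≤ mnorm (W (i + 1)) ∧
      mnorm (W (i + 1)) ≤ c₂ * mnorm (W i) ^ gam ∧
      c₃ * (mnorm (W i))⁻¹ ≤ xiNorm ξ (W i) ∧
      xiNorm ξ (W i) ≤ c₄ * (mnorm (W i))⁻¹ ∧
      c₅ ≤ |((W i).det : ℝ)| ∧ |((W i).det : ℝ)| ≤ c₆

/-- Membership in GL₂(ℤ): integer matrix of determinant ±1. -/
def InGL2Z (A : M2) : Prop := A.det = 1 ∨ A.det = -1

/-- ξ is badly approximable: irrational and |ξ - p/q| > c/q² for all rationals p/q. -/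
def BadlyApprox (ξ : ℝ) : Prop :=
  Irrational ξ ∧ ∃ c : ℝ, 0 < c ∧ ∀ p q : ℤ, q ≠ 0 → c / (q : ℝ) ^ 2 < |ξ - (p : ℝ) / (q : ℝ)|

/-- Partial quotients of the continued fraction expansion: `cfA n ξ` is `aₙ`
where ξ = [a₀, a₁, a₂, …]. -/
noncomputable def cfA : ℕ → ℝ → ℤ
  | 0, ξ => ⌊ξ⌋
  | n + 1, ξ => cfA n (ξ - ⌊ξ⌋)⁻¹

/-- A Fibonacci sequence of words (indices from 1). -/
def FibWordSeq {α : Type} (w : ℕ → List α) : Prop := ∀ i, 1 ≤ i → w (i + 2) = w (i + 1) ++ w i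

/-- `b` (indexed from 1: the limit word is b₁b₂b₃…) is the infinite limit word of the
sequence of words `w`: every `w k` (k ≥ 2) is a prefix of it, and their lengths are unbounded. -/
def IsLimitWord {α : Type} (w : ℕ → List α) (b : ℕ → α) : Prop :=
  (∀ n : ℕ, ∃ k, 2 ≤ k ∧ n ≤ (w k).length) ∧
  ∀ k, 2 ≤ k → ∀ j, (h : j < (w k).length) → (w k).get ⟨j, h⟩ = b (j + 1)

/-- The Fibonacci sequence of words over the alphabet E = {a, b} (with `b = false`,
`a = true`): w₁ = b, w₂ = a, w_{k+2} = w_{k+1} w_k.  Its limit is f_{a,b}. -/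
def fw : ℕ → List Bool
  | 0 => []
  | 1 => [false]
  | 2 => [true]
  | n + 3 => fw (n + 2) ++ fw (n + 1)

/-- The prefix of length `i` of the infinite Fibonacci word `f_{a,b}`
(note `fw (i+2)` is a prefix of `f_{a,b}` of length ≥ i). -/
def fpref (i : ℕ) : List Bool := (fw (i + 2)).take i

/-- The monoid morphism Φ : E* → (𝒫, *) with Φ(b) = W₁, Φ(a) = W₂
(the letter `b` is `false` and `a` is `true`). -/
def PhiW (W1 W2 : M2) : List Bool → M2
  | [] => 1
  | x :: u => pmul (if x then W2 else W1) (PhiW W1 W2 u)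

/-- The set 𝒮₁ of real matrices (a b; c d) with a ≥ max{b,c} and min{b,c} ≥ d ≥ 0. -/
def S1 : Set (Matrix (Fin 2) (Fin 2) ℝ) :=
  {A | max (A 0 1) (A 1 0) ≤ A 0 0 ∧ A 1 1 ≤ min (A 0 1) (A 1 0) ∧ 0 ≤ A 1 1}

/-- The set 𝒮 = 𝒮₁ ∩ GL₂(ℤ), viewed as a set of integer matrices. -/
def Sset : Set M2 :=
  {A | (A.map (Int.cast : ℤ → ℝ)) ∈ S1 ∧ (A.det = 1 ∨ A.det = -1)}

/-- ξ is an extremal real number with an associated Fibonacci sequence in GL₂(ℤ). -/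
def HasGLAssoc (ξ : ℝ) : Prop :=
  IsExtremal ξ ∧ ∃ W : ℕ → M2, IsAssociated ξ W ∧ ∀ i, 1 ≤ i → InGL2Z (W i)

/-- ξ is an extremal real number with an associated Fibonacci sequence in 𝒮. -/
def HasSAssoc (ξ : ℝ) : Prop :=
  IsExtremal ξ ∧ ∃ W : ℕ → M2, IsAssociated ξ W ∧ ∀ i, 1 ≤ i → W i ∈ Sset

/-- The row vector L = max{1,|ξ|}⁻¹ (1, ξ). -/
noncomputable def Lrow (ξ : ℝ) : Matrix (Fin 1) (Fin 2) ℝ := (max 1 |ξ|)⁻¹ • !![1, ξ]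

/-- θ = L N⁻¹ ᵗL. -/
noncomputable def theta (ξ : ℝ) (N : M2) : ℝ :=
  (Lrow ξ * (N.map (Int.cast : ℤ → ℝ))⁻¹ * (Lrow ξ)ᵀ) 0 0

/-- y_i = W_i N_i, with N_i = ᵗN for odd i and N_i = N for even i. -/
def ymat (W : ℕ → M2) (N : M2) (i : ℕ) : M2 := W i * (if i % 2 = 1 then Nᵀ else N)

/-- The maximum of the absolute values of the coefficients of a real 2×2 matrix. -/
noncomputable def rnorm (A : Matrix (Fin 2) (Fin 2) ℝ) : ℝ :=
  max (max |A 0 0| |A 0 1|) (max |A 1 0| |A 1 1|)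

lemma mnorm_eq_rnorm (A : M2) : mnorm A = rnorm (A.map (Int.cast : ℤ → ℝ)) := rfl

lemma abs_apply_le_rnorm (A : Matrix (Fin 2) (Fin 2) ℝ) (i j : Fin 2) : |A i j| ≤ rnorm A := by
  fin_cases i <;> fin_cases j <;> simp [rnorm]

lemma rnorm_le {A : Matrix (Fin 2) (Fin 2) ℝ} {c : ℝ} (h : ∀ i j, |A i j| ≤ c) : rnorm A ≤ c :=
  max_le (max_le (h 0 0) (h 0 1)) (max_le (h 1 0) (h 1 1))

lemma rnorm_nonneg (A : Matrix (Fin 2) (Fin 2) ℝ) : 0 ≤ rnorm A :=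
  (abs_nonneg _).trans (abs_apply_le_rnorm A 0 0)

lemma rnorm_smul (t : ℝ) (A : Matrix (Fin 2) (Fin 2) ℝ) : rnorm (t • A) = |t| * rnorm A := by
  simp [rnorm, abs_mul, mul_max_of_nonneg]

lemma norm_mulVec_le_of_abs_le {A : Matrix (Fin 2) (Fin 2) ℝ} {c : ℝ} (hA : ∀ i j, |A i j| ≤ c)
    (w : Fin 2 → ℝ) : ‖A *ᵥ w‖ ≤ 2 * c * ‖w‖ := by
  have hc : 0 ≤ c := (abs_nonneg _).trans (hA 0 0)
  rw [pi_norm_le_iff_of_nonneg (by positivity)]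
  intro i
  have h0 : |w 0| ≤ ‖w‖ := norm_le_pi_norm w 0
  have h1 : |w 1| ≤ ‖w‖ := norm_le_pi_norm w 1
  simp only [mulVec, dotProduct, Fin.sum_univ_two, Real.norm_eq_abs]
  calc |A i 0 * w 0 + A i 1 * w 1| ≤ |A i 0| * |w 0| + |A i 1| * |w 1| := by
        rw [← abs_mul, ← abs_mul]; exact abs_add_le _ _
    _ ≤ c * ‖w‖ + c * ‖w‖ := by gcongr <;> apply hA
    _ = _ := by ring

lemma abs_dotProduct_le_of_abs_le {v : Fin 2 → ℝ} {c : ℝ} (hv : ∀ i, |v i| ≤ c)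
    (w : Fin 2 → ℝ) : |v ⬝ᵥ w| ≤ 2 * c * ‖w‖ := by
  have hc : 0 ≤ c := (abs_nonneg _).trans (hv 0)
  have h0 : |w 0| ≤ ‖w‖ := norm_le_pi_norm w 0
  have h1 : |w 1| ≤ ‖w‖ := norm_le_pi_norm w 1
  simp only [dotProduct, Fin.sum_univ_two]
  calc |v 0 * w 0 + v 1 * w 1| ≤ |v 0| * |w 0| + |v 1| * |w 1| := by
        rw [← abs_mul, ← abs_mul]; exact abs_add_le _ _
    _ ≤ c * ‖w‖ + c * ‖w‖ := by gcongr <;> apply hv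
    _ = _ := by ring

/-- One application of a perturbation of the rank-one projector `w ↦ (v ⬝ᵥ w) • u`. -/
lemma exists_decomp_mulVec {A : Matrix (Fin 2) (Fin 2) ℝ} {u v : Fin 2 → ℝ} {e K U : ℝ}
    (hvu : v ⬝ᵥ u = 1) (hv : ∀ r, |v ⬝ᵥ r| ≤ K * ‖r‖)
    (hA : ∀ w, ‖A *ᵥ w - (v ⬝ᵥ w) • u‖ ≤ e * ‖w‖) (hu : ‖u‖ ≤ U) (hK : 1 ≤ K) (hU : 1 ≤ U)
    (he : 0 ≤ e) (a : ℝ) (r : Fin 2 → ℝ) :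
    ∃ (a' : ℝ) (r' : Fin 2 → ℝ), A *ᵥ (a • u + r) = a' • u + r' ∧
      |a'| + K * ‖r'‖ ≤ (1 + K * U * e) * (|a| + K * ‖r‖) ∧
      |a| - K * ‖r‖ - K * U * e * (|a| + K * ‖r‖) ≤ |a'| - K * ‖r'‖ := by
  have hdot : v ⬝ᵥ (a • u + r) = a + v ⬝ᵥ r := by
    rw [dotProduct_add, dotProduct_smul, hvu, smul_eq_mul, mul_one]
  have hr := norm_nonneg r
  have hw : ‖a • u + r‖ ≤ U * (|a| + K * ‖r‖) := by
    calc ‖a • u + r‖ ≤ |a| * ‖u‖ + ‖r‖ := by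
          simpa [norm_smul] using norm_add_le (a • u) r
      _ ≤ |a| * U + 1 * 1 * ‖r‖ := by rw [one_mul, one_mul]; gcongr
      _ ≤ |a| * U + U * K * ‖r‖ := by gcongr
      _ = _ := by ring
  have hE : K * ‖A *ᵥ (a • u + r) - (v ⬝ᵥ (a • u + r)) • u‖ ≤
      K * U * e * (|a| + K * ‖r‖) := by
    calc _ ≤ K * (e * (U * (|a| + K * ‖r‖))) := by
          gcongr
          exact (hA _).trans (by gcongr)
      _ = _ := by ring
  have hvr := hv r
  refine ⟨a + v ⬝ᵥ r, A *ᵥ (a • u + r) - (v ⬝ᵥ (a • u + r)) • u, ?_, ?_, ?_⟩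
  · rw [hdot]; abel
  · have := abs_add_le a (v ⬝ᵥ r)
    linarith
  · have : |a| - |v ⬝ᵥ r| ≤ |a + v ⬝ᵥ r| := by
      have h := abs_sub_abs_le_abs_sub a (-(v ⬝ᵥ r))
      rwa [abs_neg, sub_neg_eq_add] at h
    linarith

/-- Products of perturbed rank-one projectors with common image, when the perturbations have
small sum. -/
lemma exists_decomp_prod_mulVec {A : ℕ → Matrix (Fin 2) (Fin 2) ℝ} {u : Fin 2 → ℝ}
    {v : ℕ → Fin 2 → ℝ} {e : ℕ → ℝ} {K U : ℝ} (hu : ‖u‖ ≤ U) (hK : 1 ≤ K) (hU : 1 ≤ U)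
    (a : ℝ) (r : Fin 2 → ℝ) (I : List ℕ)
    (hvu : ∀ i ∈ I, v i ⬝ᵥ u = 1) (hv : ∀ i ∈ I, ∀ r, |v i ⬝ᵥ r| ≤ K * ‖r‖)
    (hA : ∀ i ∈ I, ∀ w, ‖A i *ᵥ w - (v i ⬝ᵥ w) • u‖ ≤ e i * ‖w‖) (he : ∀ i ∈ I, 0 ≤ e i)
    (hsum : (I.map fun i => K * U * e i).sum ≤ 1 / 4) :
    ∃ (a' : ℝ) (r' : Fin 2 → ℝ), (I.map A).prod *ᵥ (a • u + r) = a' • u + r' ∧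
      |a'| + K * ‖r'‖ ≤
        (1 + 2 * (I.map fun i => K * U * e i).sum) * (|a| + K * ‖r‖) ∧
      |a| - K * ‖r‖ - 2 * (I.map fun i => K * U * e i).sum * (|a| + K * ‖r‖) ≤
        |a'| - K * ‖r'‖ := by
  induction I with
  | nil => exact ⟨a, r, by simp, by simp, by simp⟩
  | cons i I ih =>
    simp only [List.map_cons, List.sum_cons, List.prod_cons] at hsum ⊢
    have hei := he i (by simp)
    have hf : 0 ≤ K * U * e i := by positivity
    obtain ⟨a₁, r₁, h₁, hS₁, hD₁⟩ := ih (fun j hj => hvu j (by simp [hj]))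
      (fun j hj => hv j (by simp [hj])) (fun j hj => hA j (by simp [hj]))
      (fun j hj => he j (by simp [hj])) (by linarith)
    obtain ⟨a₂, r₂, h₂, hS₂, hD₂⟩ := exists_decomp_mulVec (hvu i (by simp)) (hv i (by simp))
      (hA i (by simp)) hu hK hU hei a₁ r₁
    have hS : 0 ≤ |a| + K * ‖r‖ := by positivity
    have hS₁' : |a₁| + K * ‖r₁‖ ≤ 2 * (|a| + K * ‖r‖) :=
      hS₁.trans (by gcongr; linarith)
    have hmul := mul_le_mul_of_nonneg_left hS₁' hf
    refine ⟨a₂, r₂, by rw [← mulVec_mulVec, h₁, h₂], ?_, ?_⟩ <;> linarith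

/-- The coefficients of a product of perturbed rank-one projectors with common image are bounded
above and below. -/
lemma rnorm_prod_bounds {A : ℕ → Matrix (Fin 2) (Fin 2) ℝ} {u : Fin 2 → ℝ}
    {v : ℕ → Fin 2 → ℝ} {e : ℕ → ℝ} {K U : ℝ} (hu : ‖u‖ ≤ U) (hu1 : 1 ≤ ‖u‖) (hK : 1 ≤ K)
    (hU : 1 ≤ U) (I : List ℕ)
    (hvu : ∀ i ∈ I, v i ⬝ᵥ u = 1) (hv : ∀ i ∈ I, ∀ r, |v i ⬝ᵥ r| ≤ K * ‖r‖)
    (hA : ∀ i ∈ I, ∀ w, ‖A i *ᵥ w - (v i ⬝ᵥ w) • u‖ ≤ e i * ‖w‖) (he : ∀ i ∈ I, 0 ≤ e i)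
    (hsum : (I.map fun i => K * U * e i).sum ≤ 1 / 4) :
    1 / (4 * K * U) ≤ rnorm (I.map A).prod ∧ rnorm (I.map A).prod ≤ 4 * K * U := by
  constructor
  · obtain ⟨a, r, h, -, hD⟩ := exists_decomp_prod_mulVec hu hK hU 1 0 I hvu hv hA he hsum
    simp only [one_smul, add_zero, abs_one, norm_zero, mul_zero, sub_zero, mul_one] at h hD
    have hQ := norm_mulVec_le_of_abs_le (abs_apply_le_rnorm (I.map A).prod) u
    have hn := rnorm_nonneg (I.map A).prod
    have h1 : |a| - K * ‖r‖ ≤ ‖(I.map A).prod *ᵥ u‖ := by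
      rw [h]
      have h2 : ‖a • u‖ - ‖r‖ ≤ ‖a • u + r‖ := by
        simpa using norm_sub_norm_le (a • u) (-r)
      rw [norm_smul, Real.norm_eq_abs] at h2
      have h3 : |a| * 1 ≤ |a| * ‖u‖ := by gcongr
      have h4 : 1 * ‖r‖ ≤ K * ‖r‖ := by gcongr
      linarith
    have h5 : 1 / 2 ≤ 2 * rnorm (I.map A).prod * (K * U) := by
      have : ‖u‖ ≤ K * U := by nlinarith
      calc (1 / 2 : ℝ) ≤ 2 * rnorm (I.map A).prod * ‖u‖ := by linarith
        _ ≤ _ := by gcongr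
    rw [div_le_iff₀ (by positivity)]
    linarith
  · refine rnorm_le fun j k => ?_
    obtain ⟨a, r, h, hS, -⟩ :=
      exists_decomp_prod_mulVec hu hK hU 0 (Pi.single k 1) I hvu hv hA he hsum
    have hk : ‖(Pi.single k 1 : Fin 2 → ℝ)‖ = 1 := by
      rw [Pi.norm_single, norm_one]
    rw [hk, abs_zero, zero_add, mul_one] at hS
    rw [zero_smul, zero_add] at h
    have h1 : (I.map A).prod j k = (a • u + r) j := by
      rw [← h]; simp
    rw [h1]
    have h2 : |a| * ‖u‖ ≤ U * |a| := by rw [mul_comm]; gcongr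
    have h3 : 1 * 1 * ‖r‖ ≤ U * K * ‖r‖ := by gcongr
    calc |(a • u + r) j| ≤ ‖a • u + r‖ := norm_le_pi_norm (a • u + r) j
      _ ≤ |a| * ‖u‖ + ‖r‖ := by simpa [norm_smul] using norm_add_le (a • u) r
      _ ≤ U * (|a| + K * ‖r‖) := by linarith
      _ ≤ U * ((1 + 2 * (I.map fun i => K * U * e i).sum) * K) := by gcongr
      _ ≤ U * (4 * K) := by gcongr; linarith
      _ = _ := by ring

/-- A real symmetric matrix `y` with `(ξ, -1) y` small is close to a multiple of
`ᵗ(1, ξ) (1, ξ)`. -/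
lemma exists_sign_approx {ξ δ : ℝ} {y : Matrix (Fin 2) (Fin 2) ℝ} (hy : y 0 1 = y 1 0)
    (h0 : |ξ * y 0 0 - y 1 0| ≤ δ) (h1 : |ξ * y 0 1 - y 1 1| ≤ δ) :
    ∃ σ : ℝ, |σ| = 1 ∧ ∀ i j,
      |y i j - σ * rnorm y / (max 1 |ξ|) ^ 2 * (![1, ξ] i * ![1, ξ] j)| ≤
        2 * (1 + |ξ|) * δ := by
  set m := max 1 |ξ| with hm
  have hm1 : 1 ≤ m := le_max_left _ _
  have hmξ : |ξ| ≤ m := le_max_right _ _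
  have hξ := abs_nonneg ξ
  have hδ : 0 ≤ δ := (abs_nonneg _).trans h0
  have hu : ∀ i, |(![1, ξ] : Fin 2 → ℝ) i| ≤ m := by
    intro i; fin_cases i <;> simp [hm]
  have happ : ∀ i j, |y i j - y 0 0 * (![1, ξ] i * ![1, ξ] j)| ≤ (1 + |ξ|) * δ := by
    have hξδ : 0 ≤ |ξ| * δ := by positivity
    have h10 : |y 1 0 - y 0 0 * ξ| ≤ (1 + |ξ|) * δ := by
      rw [abs_sub_comm, mul_comm (y 0 0)]; linarith
    have h11 : |y 1 1 - y 0 0 * (ξ * ξ)| ≤ (1 + |ξ|) * δ := by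
      have : y 1 1 - y 0 0 * (ξ * ξ) =
          -(ξ * y 0 1 - y 1 1) - ξ * (ξ * y 0 0 - y 1 0) := by rw [hy]; ring
      rw [this]
      refine (abs_sub _ _).trans ?_
      rw [abs_neg, abs_mul]
      have := mul_le_mul_of_nonneg_left h0 hξ
      linarith
    intro i j
    fin_cases i <;> fin_cases j
    · simp; positivity
    · simpa [hy] using h10
    · simpa using h10
    · simpa using h11
  have hup : rnorm y ≤ m ^ 2 * |y 0 0| + (1 + |ξ|) * δ := by
    refine rnorm_le fun i j => ?_
    have h := abs_sub_abs_le_abs_sub (y i j) (y 0 0 * (![1, ξ] i * ![1, ξ] j))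
    have h' : |y 0 0 * (![1, ξ] i * ![1, ξ] j)| ≤ |y 0 0| * (m * m) := by
      rw [abs_mul, abs_mul]
      gcongr <;> apply hu
    have := happ i j
    linarith
  have hlow : m ^ 2 * |y 0 0| - (1 + |ξ|) * δ ≤ rnorm y := by
    have key : ∀ i, m = |(![1, ξ] : Fin 2 → ℝ) i| →
        m ^ 2 * |y 0 0| - (1 + |ξ|) * δ ≤ rnorm y := by
      intro i hi
      have h := abs_sub_abs_le_abs_sub (y 0 0 * (![1, ξ] i * ![1, ξ] i)) (y i i)
      rw [abs_sub_comm, abs_mul, abs_mul, ← hi] at h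
      have := happ i i
      have := abs_apply_le_rnorm y i i
      linarith
    rcases max_choice 1 |ξ| with h | h
    · exact key 0 (by simpa [hm] using h)
    · exact key 1 (by simpa [hm] using h)
  obtain ⟨σ, hσ, hσy⟩ : ∃ σ : ℝ, |σ| = 1 ∧ y 0 0 = σ * |y 0 0| := by
    rcases le_total 0 (y 0 0) with h | h
    · exact ⟨1, by simp, by rw [abs_of_nonneg h, one_mul]⟩
    · exact ⟨-1, by simp, by rw [abs_of_nonpos h]; ring⟩
  refine ⟨σ, hσ, fun i j => ?_⟩
  have hm0 : 0 < m := by linarith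
  have hdiff : |y 0 0 - σ * rnorm y / m ^ 2| * (m * m) ≤ (1 + |ξ|) * δ := by
    have : y 0 0 - σ * rnorm y / m ^ 2 = σ * (m ^ 2 * |y 0 0| - rnorm y) / (m * m) := by
      nth_rw 1 [hσy]; field_simp
    rw [this, abs_div, abs_mul, hσ, one_mul, abs_of_pos (by positivity : 0 < m * m),
      div_mul_cancel₀ _ (by positivity), abs_le]
    constructor <;> linarith
  have hsplit : y i j - σ * rnorm y / m ^ 2 * (![1, ξ] i * ![1, ξ] j) =
      (y i j - y 0 0 * (![1, ξ] i * ![1, ξ] j)) +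
        (y 0 0 - σ * rnorm y / m ^ 2) * (![1, ξ] i * ![1, ξ] j) := by ring
  rw [hsplit]
  refine (abs_add_le _ _).trans ?_
  have h2 : |(y 0 0 - σ * rnorm y / m ^ 2) * (![1, ξ] i * ![1, ξ] j)| ≤ (1 + |ξ|) * δ := by
    refine le_trans ?_ hdiff
    rw [abs_mul, abs_mul (![1, ξ] i)]
    gcongr <;> apply hu
  have := happ i j
  linarith

/-- The value at `(1, ξ)` of the quadratic form of the adjugate of `N`. -/
noncomputable def adjForm (ξ : ℝ) (N : M2) : ℝ :=
  (N 1 1 : ℝ) - (N 0 1 + N 1 0 : ℝ) * ξ + N 0 0 * ξ ^ 2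

lemma theta_eq (ξ : ℝ) (N : M2) :
    theta ξ N = adjForm ξ N / (N.det * (max 1 |ξ|) ^ 2) := by
  have hdet : (N.map (Int.cast : ℤ → ℝ)).det = (N.det : ℝ) := by
    simp [det_fin_two]
  have hm : max 1 |ξ| ≠ 0 := (lt_of_lt_of_le one_pos (le_max_left _ _)).ne'
  rw [theta, inv_def, hdet, Ring.inverse_eq_inv', adjugate_fin_two]
  simp [Lrow, adjForm, mul_apply, Fin.sum_univ_two]
  field_simp
  ring

lemma adjForm_ne_zero {ξ : ℝ} {N : M2} (hξ : IsExtremal ξ) (hN : N ≠ -Nᵀ) :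
    adjForm ξ N ≠ 0 := by
  have h := hξ.1 (N 0 0) (-(N 0 1 + N 1 0)) (N 1 1) (by
    rintro ⟨h0, h1, h2⟩
    apply hN
    have h0' : N 0 0 = 0 := by exact_mod_cast h0
    have h2' : N 1 1 = 0 := by exact_mod_cast h2
    have h1' : N 0 1 + N 1 0 = 0 := by exact_mod_cast neg_eq_zero.mp h1
    ext i j
    fin_cases i <;> fin_cases j <;> simp [h0', h2'] <;> linarith)
  intro h0
  apply h
  rw [adjForm] at h0
  push_cast
  linarith

lemma one_le_mnorm {A : M2} (hA : A.det ≠ 0) : 1 ≤ mnorm A := by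
  by_contra! h
  have h0 : ∀ i j, A i j = 0 := by
    intro i j
    have h1 : |((A i j : ℤ) : ℝ)| < 1 :=
      (abs_apply_le_rnorm (A.map (Int.cast : ℤ → ℝ)) i j).trans_lt h
    exact Int.abs_lt_one_iff.mp (by exact_mod_cast h1)
  exact hA (by simp [det_fin_two, h0])

/-- The reciprocals of the terms of an unbounded sequence growing at least like iterates of a
power with exponent larger than one are summable. -/
lemma summable_inv_of_rpow_growth {X : ℕ → ℝ} {c g : ℝ} (hc : 0 < c) (hg : 1 < g)
    (hX : ∀ i, 1 ≤ i → c * X i ^ g ≤ X (i + 1)) (hunb : ∀ C, ∃ i, 1 ≤ i ∧ C < X i) :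
    Summable fun i => (X i)⁻¹ := by
  have hev : ∀ᶠ x : ℝ in Filter.atTop, 2 / c ≤ x ^ (g - 1) :=
    (tendsto_rpow_atTop (by linarith)).eventually_ge_atTop _
  obtain ⟨C, hC⟩ := Filter.eventually_atTop.mp hev
  obtain ⟨k, hk, hkX⟩ := hunb (max 1 C)
  have hstep : ∀ i, 1 ≤ i → max 1 C ≤ X i → 2 * X i ≤ X (i + 1) := by
    intro i hi hiX
    have h1 : 0 < X i := lt_of_lt_of_le one_pos ((le_max_left _ _).trans hiX)
    have h2 := hC (X i) ((le_max_right _ _).trans hiX)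
    rw [div_le_iff₀ hc] at h2
    calc 2 * X i ≤ X i ^ (g - 1) * c * X i := by gcongr
      _ = c * (X i ^ (g - 1) * X i) := by ring
      _ = c * X i ^ g := by rw [← Real.rpow_add_one h1.ne']; ring_nf
      _ ≤ _ := hX i hi
  have hgrow : ∀ n, max 1 C ≤ X (n + k) ∧ 2 ^ n ≤ X (n + k) := by
    intro n
    induction n with
    | zero => simpa using ⟨max_le_iff.mp hkX.le, (le_max_left 1 C).trans hkX.le⟩
    | succ n ih =>
      have h := hstep (n + k) (by omega) ih.1
      have h1 := (le_max_left 1 C).trans ih.1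
      rw [add_right_comm, pow_succ]
      exact ⟨by linarith [ih.1], by linarith [ih.2]⟩
  rw [← summable_nat_add_iff k]
  refine Summable.of_nonneg_of_le (fun n => inv_nonneg.mpr ?_) (fun n => ?_)
    (summable_geometric_two)
  · exact zero_le_one.trans ((le_max_left 1 C).trans (hgrow n).1)
  · rw [one_div, inv_pow]
    exact inv_anti₀ (by positivity) (hgrow n).2

/-- Tails of a summable nonnegative sequence control sums over lists without many repetitions. -/
lemma exists_list_sum_le {f : ℕ → ℝ} (hf : Summable f) (hf0 : ∀ i, 1 ≤ i → 0 ≤ f i)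
    {ε : ℝ} (hε : 0 < ε) :
    ∃ l : ℕ, 1 ≤ l ∧ ∀ I : List ℕ, (∀ i ∈ I, l ≤ i) → (∀ n, I.count n ≤ 2) →
      (I.map f).sum ≤ ε := by
  obtain ⟨s, hs⟩ := summable_iff_vanishing_norm.mp hf (ε / 2) (by positivity)
  refine ⟨s.sup id + 1, by omega, fun I hI hcount => ?_⟩
  have hdisj : Disjoint I.toFinset s := by
    rw [Finset.disjoint_left]
    intro i hi his
    have h1 := hI i (List.mem_toFinset.mp hi)
    have h2 : i ≤ s.sup id := Finset.le_sup (f := id) his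
    omega
  have h := (le_abs_self _).trans (hs _ hdisj).le
  rw [Finset.sum_list_map_count]
  calc ∑ m ∈ I.toFinset, I.count m • f m ≤ ∑ m ∈ I.toFinset, 2 * f m := by
        refine Finset.sum_le_sum fun m hm => ?_
        have hm0 := hf0 m (le_trans (by omega) (hI m (List.mem_toFinset.mp hm)))
        rw [nsmul_eq_mul]
        gcongr
        exact_mod_cast hcount m
    _ = 2 * ∑ m ∈ I.toFinset, f m := by rw [Finset.mul_sum]
    _ ≤ ε := by linarith

lemma list_map_smul_prod (t : ℕ → ℝ) (A : ℕ → Matrix (Fin 2) (Fin 2) ℝ) (I : List ℕ) :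
    (I.map fun i => t i • A i).prod = (I.map t).prod • (I.map A).prod := by
  induction I with
  | nil => simp
  | cons i I ih => simp only [List.map_cons, List.prod_cons, ih, smul_mul_smul_comm]

lemma mnorm_list_prod (W : ℕ → M2) (I : List ℕ) :
    mnorm (I.map W).prod =
      rnorm (I.map fun i => (W i).map (Int.cast : ℤ → ℝ)).prod := by
  rw [mnorm_eq_rnorm]
  congr 1
  have := map_list_prod ((Int.castRingHom ℝ).mapMatrix (m := Fin 2)) (I.map W)
  rw [List.map_map] at this
  exact this

/-- If `A n` is symmetric and `(ξ, -1) A` is small then `A` is, up to a scalar, close to a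
rank-one projector with image spanned by `(1, ξ)`. -/
lemma exists_projector_approx {ξ δ b : ℝ} {A n : M2} (hsymm : (A * n).IsSymm)
    (hA : A.det ≠ 0) (hn : n.det ≠ 0) (hκ : adjForm ξ n ≠ 0)
    (hb : ∀ i j, |(n i j : ℝ)| ≤ b) (hδ : xiNorm ξ A ≤ δ) :
    ∃ (t : ℝ) (v : Fin 2 → ℝ), |t| = |theta ξ n| * mnorm (A * n) ∧ t ≠ 0 ∧
      v ⬝ᵥ ![1, ξ] = 1 ∧ (∀ i, |v i| ≤ (1 + |ξ|) * b / |adjForm ξ n|) ∧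
      ∀ w, ‖(t⁻¹ • A.map (Int.cast : ℤ → ℝ)) *ᵥ w - (v ⬝ᵥ w) • ![1, ξ]‖ ≤
        16 * (1 + |ξ|) * b ^ 2 * (max 1 |ξ|) ^ 2 / |adjForm ξ n| * δ * ‖w‖ := by
  set κ := adjForm ξ n with hκdef
  set m := max 1 |ξ| with hm
  have hm0 : 0 < m := lt_of_lt_of_le one_pos (le_max_left _ _)
  have hξ := abs_nonneg ξ
  have hb0 : 0 ≤ b := (abs_nonneg _).trans (hb 0 0)
  have hδ0 : 0 ≤ δ := ((abs_nonneg _).trans (le_max_left _ _)).trans hδ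
  have hκ0 : 0 < |κ| := abs_pos.mpr hκ
  have hD : (n.det : ℝ) ≠ 0 := by exact_mod_cast hn
  set y : Matrix (Fin 2) (Fin 2) ℝ := (A * n).map (Int.cast : ℤ → ℝ) with hy
  have hyent : ∀ i j, y i j = A i 0 * n 0 j + A i 1 * n 1 j := by
    intro i j; simp [hy, mul_apply, Fin.sum_univ_two]
  have hY1 : 1 ≤ rnorm y := one_le_mnorm (by rw [det_mul]; exact mul_ne_zero hA hn)
  have hrow : ∀ j, |ξ * y 0 j - y 1 j| ≤ 2 * b * δ := by
    intro j
    have h0 : |ξ * A 0 0 - A 1 0| ≤ δ := (le_max_left _ _).trans hδ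
    have h1 : |ξ * A 0 1 - A 1 1| ≤ δ := (le_max_right _ _).trans hδ
    have : ξ * y 0 j - y 1 j =
        (ξ * A 0 0 - A 1 0) * n 0 j + (ξ * A 0 1 - A 1 1) * n 1 j := by
      rw [hyent, hyent]; ring
    rw [this]
    refine (abs_add_le _ _).trans ?_
    rw [abs_mul, abs_mul]
    calc _ ≤ δ * b + δ * b := by gcongr <;> apply hb
      _ = _ := by ring
  have hysymm : y 0 1 = y 1 0 := by
    simp only [hy, map_apply]
    rw [hsymm.apply]
  obtain ⟨σ, hσ, happ⟩ := exists_sign_approx hysymm (hrow 0) (hrow 1)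
  have hσ0 : σ ≠ 0 := by rintro rfl; simp at hσ
  set B : Matrix (Fin 2) (Fin 2) ℝ := !![(n 1 1 : ℝ), -n 0 1; -n 1 0, n 0 0] with hB
  have hBb : ∀ i j, |B i j| ≤ b := by
    intro i j
    fin_cases i <;> fin_cases j <;> simp [hB, hb]
  have hyB : y * B = (n.det : ℝ) • A.map (Int.cast : ℤ → ℝ) := by
    ext i j
    fin_cases j <;>
    simp [mul_apply, Fin.sum_univ_two, hyent, hB, det_fin_two] <;> ring
  have htheta : theta ξ n = κ / (n.det * m ^ 2) := theta_eq ξ n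
  have hθ : theta ξ n ≠ 0 := by rw [htheta]; positivity
  have hY0 : rnorm y ≠ 0 := by linarith
  have ht0 : theta ξ n * (σ * rnorm y) ≠ 0 := mul_ne_zero hθ (mul_ne_zero hσ0 hY0)
  refine ⟨theta ξ n * (σ * rnorm y), fun j => (B 0 j + ξ * B 1 j) / κ, ?_, ht0, ?_, ?_, ?_⟩
  · rw [abs_mul, abs_mul, hσ, one_mul, abs_of_nonneg (rnorm_nonneg y)]; rfl
  · simp [dotProduct, Fin.sum_univ_two, hB]
    field_simp
    rw [hκdef, adjForm]; ring
  · intro j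
    rw [abs_div]
    gcongr
    refine (abs_add_le _ _).trans ?_
    rw [abs_mul]
    have h0 := hBb 0 j
    have h1 := mul_le_mul_of_nonneg_left (hBb 1 j) hξ
    linarith
  · set t := theta ξ n * (σ * rnorm y) with ht
    set v : Fin 2 → ℝ := fun j => (B 0 j + ξ * B 1 j) / κ with hv
    have htD : |t * n.det| = |κ| * rnorm y / m ^ 2 := by
      have : t * n.det = κ * (σ * rnorm y) / m ^ 2 := by
        rw [ht, htheta]; field_simp
      rw [this, abs_div, abs_mul, abs_mul, hσ, one_mul, abs_of_nonneg (rnorm_nonneg y),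
        abs_of_pos (by positivity : 0 < m ^ 2)]
    have hent : ∀ i j, |(t⁻¹ • A.map (Int.cast : ℤ → ℝ) - vecMulVec ![1, ξ] v) i j| ≤
        8 * (1 + |ξ|) * b ^ 2 * m ^ 2 / |κ| * δ := by
      intro i j
      have hAij : (A i j : ℝ) = (y i 0 * B 0 j + y i 1 * B 1 j) / n.det := by
        have := congrFun (congrFun hyB i) j
        simp only [mul_apply, Fin.sum_univ_two, Matrix.smul_apply, map_apply, smul_eq_mul] at this
        rw [this]; field_simp
      have heq : (t⁻¹ • A.map (Int.cast : ℤ → ℝ) - vecMulVec ![1, ξ] v) i j =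
          ((y i 0 - σ * rnorm y / m ^ 2 * (![1, ξ] i * ![1, ξ] 0)) * B 0 j +
            (y i 1 - σ * rnorm y / m ^ 2 * (![1, ξ] i * ![1, ξ] 1)) * B 1 j) /
              (t * n.det) := by
        simp only [Matrix.sub_apply, Matrix.smul_apply, map_apply, vecMulVec_apply, smul_eq_mul, hAij, hv]
        rw [ht, htheta]
        simp only [cons_val_zero, cons_val_one]
        field_simp
        ring
      have hnum : |(y i 0 - σ * rnorm y / m ^ 2 * (![1, ξ] i * ![1, ξ] 0)) * B 0 j +
            (y i 1 - σ * rnorm y / m ^ 2 * (![1, ξ] i * ![1, ξ] 1)) * B 1 j| ≤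
          8 * (1 + |ξ|) * b ^ 2 * δ := by
        refine (abs_add_le _ _).trans ?_
        rw [abs_mul, abs_mul _ (B 1 j)]
        calc _ ≤ 2 * (1 + |ξ|) * (2 * b * δ) * b + 2 * (1 + |ξ|) * (2 * b * δ) * b := by
              gcongr
              · exact happ i 0
              · exact hBb 0 j
              · exact happ i 1
              · exact hBb 1 j
          _ = _ := by ring
      have hden : |κ| / m ^ 2 ≤ |t * n.det| := by
        rw [htD]
        gcongr
        exact le_mul_of_one_le_right hκ0.le hY1
      rw [heq, abs_div]
      calc _ ≤ 8 * (1 + |ξ|) * b ^ 2 * δ / (|κ| / m ^ 2) := by gcongr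
        _ = _ := by field_simp
    intro w
    have h := norm_mulVec_le_of_abs_le hent w
    have hvec : vecMulVec ![1, ξ] v *ᵥ w = (v ⬝ᵥ w) • ![1, ξ] := by
      rw [vecMulVec_mulVec, op_smul_eq_smul]
    rw [sub_mulVec, hvec] at h
    refine h.trans (le_of_eq ?_)
    ring

lemma adjForm_transpose (ξ : ℝ) (N : M2) : adjForm ξ Nᵀ = adjForm ξ N := by
  simp [adjForm, add_comm]

lemma theta_transpose (ξ : ℝ) (N : M2) : theta ξ Nᵀ = theta ξ N := by
  rw [theta_eq, theta_eq, adjForm_transpose, det_transpose]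

/-- θ ≠ 0 and, for suitable ℓ ≥ 1 and c ≥ 1, every product W_{i₁}⋯W_{i_s} with all indices
≥ ℓ and no index repeated more than twice satisfies
1/c ≤ ‖W_{i₁}⋯W_{i_s}‖ / (|θ|^s ‖y_{i₁}‖⋯‖y_{i_s}‖) ≤ c. -/
theorem stmt15 (ξ : ℝ) (W : ℕ → M2) (N : M2)
    (hξ : IsExtremal ξ) (hW : IsAssociated ξ W)
    (hN : MemP N) (hN1 : N ≠ Nᵀ) (hN2 : N ≠ -Nᵀ)
    (hsym : ∀ i, 1 ≤ i → (ymat W N i).IsSymm) :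
    theta ξ N ≠ 0 ∧
    ∃ l : ℕ, 1 ≤ l ∧ ∃ c : ℝ, 1 ≤ c ∧
      ∀ I : List ℕ, (∀ i ∈ I, l ≤ i) → (∀ n : ℕ, I.count n ≤ 2) →
        1 / c ≤ mnorm (I.map W).prod /
            (|theta ξ N| ^ I.length * (I.map (fun i => mnorm (ymat W N i))).prod) ∧
        mnorm (I.map W).prod /
            (|theta ξ N| ^ I.length * (I.map (fun i => mnorm (ymat W N i))).prod) ≤ c := by
  have hκ : adjForm ξ N ≠ 0 := adjForm_ne_zero hξ hN2
  obtain ⟨⟨hWP, -⟩, hunb, -, c₁, c₂, c₃, c₄, c₅, c₆, hc₁, -, -, hc₄, -, -, hW⟩ := hW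
  have hm0 : 0 < max 1 |ξ| := lt_of_lt_of_le one_pos (le_max_left _ _)
  have hD : (N.det : ℝ) ≠ 0 := by exact_mod_cast hN.2
  refine ⟨by rw [theta_eq]; positivity, ?_⟩
  set b := mnorm N with hb
  set C := 16 * (1 + |ξ|) * b ^ 2 * (max 1 |ξ|) ^ 2 / |adjForm ξ N| with hC
  have hC0 : 0 ≤ C := by positivity
  set e : ℕ → ℝ := fun i => C * (c₄ * (mnorm (W i))⁻¹) with he
  have hmain : ∀ i, ∃ (t : ℝ) (v : Fin 2 → ℝ), 1 ≤ i →
      |t| = |theta ξ N| * mnorm (ymat W N i) ∧ t ≠ 0 ∧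
      v ⬝ᵥ ![1, ξ] = 1 ∧ (∀ j, |v j| ≤ (1 + |ξ|) * b / |adjForm ξ N|) ∧
      ∀ w, ‖(t⁻¹ • (W i).map (Int.cast : ℤ → ℝ)) *ᵥ w - (v ⬝ᵥ w) • ![1, ξ]‖ ≤
        e i * ‖w‖ := by
    intro i
    by_cases hi : 1 ≤ i
    swap
    · exact ⟨0, 0, fun h => absurd h hi⟩
    have hbN : ∀ j k, |(N j k : ℝ)| ≤ b :=
      abs_apply_le_rnorm (N.map (Int.cast : ℤ → ℝ))
    have hsy := hsym i hi
    have hxi := (hW i hi).2.2.2.1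
    rw [ymat] at hsy ⊢
    split_ifs at hsy ⊢ with hodd
    · obtain ⟨t, v, h⟩ := exists_projector_approx hsy (hWP i hi).2
        (by rw [det_transpose]; exact hN.2) (by rwa [adjForm_transpose])
        (fun j k => hbN k j) hxi
      rw [adjForm_transpose, theta_transpose] at h
      exact ⟨t, v, fun _ => h⟩
    · obtain ⟨t, v, h⟩ := exists_projector_approx hsy (hWP i hi).2 hN.2 hκ hbN hxi
      exact ⟨t, v, fun _ => h⟩
  choose t v htv using hmain
  have he0 : ∀ i, 1 ≤ i → 0 ≤ e i := by
    intro i hi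
    have := one_le_mnorm (hWP i hi).2
    simp only [he]
    positivity
  set K := 1 + 2 * ((1 + |ξ|) * b / |adjForm ξ N|) with hK
  have hb0 : 0 ≤ b := rnorm_nonneg (N.map (Int.cast : ℤ → ℝ))
  have hK1 : 1 ≤ K := by
    rw [hK]
    exact le_add_of_nonneg_right (by positivity)
  have hu : ‖(![1, ξ] : Fin 2 → ℝ)‖ ≤ 1 + |ξ| := by
    rw [pi_norm_le_iff_of_nonneg (by positivity)]
    intro j
    fin_cases j <;> simp
  have hu1 : 1 ≤ ‖(![1, ξ] : Fin 2 → ℝ)‖ := by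
    simpa using norm_le_pi_norm (![1, ξ] : Fin 2 → ℝ) 0
  have hU : 1 ≤ 1 + |ξ| := le_add_of_nonneg_right (abs_nonneg ξ)
  have hgam : 1 < gam := Real.one_lt_goldenRatio
  have hsummable : Summable fun i => K * (1 + |ξ|) * e i :=
    (((summable_inv_of_rpow_growth hc₁ hgam (fun i hi => (hW i hi).1) hunb).mul_left
      c₄).mul_left C).mul_left _
  obtain ⟨l, hl, hlsum⟩ := exists_list_sum_le hsummable
    (fun i hi => by have := he0 i hi; positivity) (ε := 1 / 4) (by norm_num)
  refine ⟨l, hl, 4 * K * (1 + |ξ|), by nlinarith, fun I hI hcount => ?_⟩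
  have hI1 : ∀ i ∈ I, 1 ≤ i := fun i hi => hl.trans (hI i hi)
  have hbd := rnorm_prod_bounds (A := fun i => (t i)⁻¹ • (W i).map (Int.cast : ℤ → ℝ))
    (v := v) (e := e) hu hu1 hK1 hU I (fun i hi => (htv i (hI1 i hi)).2.2.1)
    (fun i hi r => (abs_dotProduct_le_of_abs_le (htv i (hI1 i hi)).2.2.2.1 r).trans (by
      gcongr; linarith))
    (fun i hi => (htv i (hI1 i hi)).2.2.2.2) (fun i hi => he0 i (hI1 i hi))
    (hlsum I hI hcount)
  have hden : |theta ξ N| ^ I.length * (I.map (fun i => mnorm (ymat W N i))).prod =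
      |(I.map t).prod| := by
    clear hbd hcount hI
    induction I with
    | nil => simp
    | cons i I ih =>
      have := ih (fun j hj => hI1 j (by simp [hj]))
      simp only [List.map_cons, List.prod_cons, List.length_cons, abs_mul, ← this,
        (htv i (hI1 i (by simp))).1]
      ring
  have ht0 : (I.map t).prod ≠ 0 := by
    refine List.prod_ne_zero fun h => ?_
    obtain ⟨i, hi, h⟩ := List.mem_map.mp h
    exact (htv i (hI1 i hi)).2.1 h
  have hprod : mnorm (I.map W).prod = |(I.map t).prod| *
      rnorm (I.map fun i => (t i)⁻¹ • (W i).map (Int.cast : ℤ → ℝ)).prod := by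
    rw [mnorm_list_prod, ← rnorm_smul, ← list_map_smul_prod]
    congr 2
    refine List.map_congr_left fun i hi => ?_
    rw [smul_inv_smul₀ (htv i (hI1 i hi)).2.1]
  rw [hden, hprod, mul_div_cancel_left₀ _ (abs_ne_zero.mpr ht0)]
  exact hbd
end

section
/- Let m be a nonzero integer and let W ∈ M₂(ℤ) satisfy W² ≡ 0 (mod m). Assume W₁, W₂ ∈ M₂(ℤ) are primitive matrices of determinant m with W₁ ≡ W (mod m) and W₂ ≡ W (mod m), and let Φ: E* → (𝒫,*) be the morphism of monoids with Φ(a) = W₂ and Φ(b) = W₁. Then for every word u ∈ E*, det Φ(u) = 1 if u has even length and det Φ(u) = m if u has odd length. -/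
open Matrix

theorem dvd_content_iff (A : M2) (d : ℕ) : d ∣ content A ↔ ∀ i j, (d : ℤ) ∣ A i j := by
  simp only [content, Nat.dvd_gcd_iff, Fin.forall_fin_two, Int.natCast_dvd]

theorem content_dvd_content_mul (A B : M2) : content A ∣ content (A * B) := by
  have h := (dvd_content_iff A _).1 dvd_rfl
  refine (dvd_content_iff _ _).2 fun i j => ?_
  rw [Matrix.mul_apply]
  exact Finset.dvd_sum fun k _ => (h i k).mul_right _

/-- Right multiplication by a matrix of determinant one preserves the content. -/
theorem content_mul_of_det_eq_one (A U : M2) (hU : U.det = 1) :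
    content (A * U) = content A := by
  refine Nat.dvd_antisymm ?_ (content_dvd_content_mul A U)
  have h := content_dvd_content_mul (A * U) U.adjugate
  rwa [Matrix.mul_assoc, Matrix.mul_adjugate, hU, one_smul, Matrix.mul_one] at h

theorem content_smul_of_det_eq_one (m : ℤ) (V : M2) (hV : V.det = 1) :
    content (m • V) = m.natAbs := by
  have h := content_mul_of_det_eq_one (m • (1 : M2)) V hV
  rw [Matrix.smul_mul, Matrix.one_mul] at h
  simpa [content] using h

theorem red_eq_self {A : M2} (hA : Primitive A) : red A = A := by
  ext i j
  simp [red, show content A = 1 from hA]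

theorem content_smul_red (A : M2) : (content A : ℤ) • red A = A := by
  ext i j
  simpa [red] using Int.mul_ediv_cancel' ((dvd_content_iff A _).1 dvd_rfl i j)

theorem content_sq_mul_det_red (A : M2) : (content A : ℤ) ^ 2 * (red A).det = A.det := by
  have h := congrArg Matrix.det (content_smul_red A)
  rwa [Matrix.det_smul, Fintype.card_fin] at h

theorem det_red_smul_of_det_eq_one {m : ℤ} (hm : m ≠ 0) {V : M2} (hV : V.det = 1) :
    (red (m • V)).det = 1 := by
  have h := content_sq_mul_det_red (m • V)
  rw [content_smul_of_det_eq_one m V hV, Int.natCast_natAbs, sq_abs, Matrix.det_smul, hV] at h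
  exact mul_left_cancel₀ (pow_ne_zero 2 hm) (by simpa using h)

/-- Two matrices of determinant `m` congruent modulo `m` to one whose square vanishes modulo `m`
have a product equal to `m` times a matrix of determinant one. -/
theorem exists_mul_eq_smul_det_eq_one {m : ℤ} (hm : m ≠ 0) {W X Y : M2}
    (hsq : ∀ i j, m ∣ (W * W) i j) (hX : X.det = m) (hY : Y.det = m)
    (hXW : ∀ i j, m ∣ X i j - W i j) (hYW : ∀ i j, m ∣ Y i j - W i j) :
    ∃ V : M2, V.det = 1 ∧ X * Y = m • V := by
  have hdvd : ∀ i j, m ∣ (X * Y) i j := fun i j => by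
    have h : X * Y = (X - W) * Y + W * (Y - W) + W * W := by noncomm_ring
    rw [h, Matrix.add_apply, Matrix.add_apply, Matrix.mul_apply, Matrix.mul_apply]
    exact dvd_add (dvd_add (Finset.dvd_sum fun k _ => (hXW i k).mul_right _)
      (Finset.dvd_sum fun k _ => (hYW k j).mul_left _)) (hsq i j)
  choose V hV using hdvd
  have hXY : X * Y = m • (Matrix.of V : M2) := by
    ext i j
    simpa using hV i j
  refine ⟨Matrix.of V, ?_, hXY⟩
  have h := congrArg Matrix.det hXY
  rw [Matrix.det_mul, hX, hY, Matrix.det_smul] at h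
  refine mul_left_cancel₀ (pow_ne_zero 2 hm) ?_
  simpa [sq] using h.symm

/-- If W² ≡ 0 mod m and W₁, W₂ are primitive of determinant m congruent to W mod m, then for
each word u, det Φ(u) = 1 if u has even length and m if u has odd length. -/
theorem stmt17 (m : ℤ) (hm : m ≠ 0) (Wm W1 W2 : M2)
    (hsq : ∀ i j, m ∣ (Wm * Wm) i j)
    (h1p : Primitive W1) (h2p : Primitive W2)
    (h1d : W1.det = m) (h2d : W2.det = m)
    (h1c : ∀ i j, m ∣ (W1 i j - Wm i j)) (h2c : ∀ i j, m ∣ (W2 i j - Wm i j)) :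
    ∀ u : List Bool, (PhiW W1 W2 u).det = if u.length % 2 = 0 then 1 else m := by
  set L : Bool → M2 := fun x => if x then W2 else W1 with hL
  have hLp : ∀ x, Primitive (L x) := by rintro (_ | _) <;> simpa [hL]
  have hLd : ∀ x, (L x).det = m := by rintro (_ | _) <;> simpa [hL]
  have hLc : ∀ x i j, m ∣ L x i j - Wm i j := by
    rintro (_ | _)
    exacts [h1c, h2c]
  have key : ∀ u : List Bool,
      (u.length % 2 = 0 → (PhiW W1 W2 u).det = 1) ∧
      (u.length % 2 = 1 → ∃ x, ∃ U : M2, U.det = 1 ∧ PhiW W1 W2 u = L x * U) := by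
    intro u
    induction u with
    | nil => simp [PhiW]
    | cons x u ih =>
      have hcons : PhiW W1 W2 (x :: u) = red (L x * PhiW W1 W2 u) := rfl
      rw [List.length_cons, hcons]
      constructor
      · intro h
        obtain ⟨y, U, hU, hu⟩ := ih.2 (by omega)
        obtain ⟨V, hV, hxy⟩ := exists_mul_eq_smul_det_eq_one hm hsq (hLd x) (hLd y) (hLc x) (hLc y)
        rw [hu, ← Matrix.mul_assoc, hxy, Matrix.smul_mul]
        exact det_red_smul_of_det_eq_one hm (by rw [Matrix.det_mul, hV, hU, one_mul])
      · intro h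
        have hU := ih.1 (by omega)
        exact ⟨x, _, hU, red_eq_self ((content_mul_of_det_eq_one _ _ hU).trans (hLp x))⟩
  intro u
  split_ifs with h
  · exact (key u).1 h
  · obtain ⟨x, U, hU, hu⟩ := (key u).2 (by omega)
    rw [hu, Matrix.det_mul, hLd, hU, mul_one]
end
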